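/- Let δ₁,…,δₙ be positive integers, let N = J × … × J ⊆ R^s (s factors) where J = ⟨X₁^{δ₁},…,Xₙ^{δₙ}⟩ ⊆ R, let F ∈ R^{r×s}, let ≤ be a monomial order on R^r, and let G = (p₁,…,p_k) be a minimal ≤-Gröbner basis of Syz_N(F). Let G' = (p₁',…,p_k') be obtained by deleting from each p_i all terms whose monomial lies in the submodule J'×…×J' with J' = ⟨X₁^{δ₁+1},…,Xₙ^{δₙ+1}⟩ (i.e., truncating each polynomial modulo ⟨X₁^{δ₁+1},…,Xₙ^{δₙ+1}⟩ in each coordinate). Then G' is again a minimal ≤-Gröbner basis of Syz_N(F). -/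

import Mathlib

open MvPolynomial

/-! ### Monomials of the free module `R^r`, monomial orders, Gröbner bases

Here `R = K[X₁,…,Xₙ]` is `MvPolynomial (Fin n) K` and the free module `R^r`
is `Fin r → MvPolynomial (Fin n) K` (row vectors).  A monomial `ν eᵢ` of `R^r`
is encoded as a pair `(ν, i)`. -/

/-- A monomial of the free module `R^r`: an exponent vector in `n` variables
together with the index of the coordinate vector supporting it. -/
abbrev ModMon (n r : ℕ) := (Fin n →₀ ℕ) × Fin r

/-- Multiplication of a module monomial by a ring monomial. -/
noncomputable def smulMon {n r : ℕ} (ν : Fin n →₀ ℕ) (μ : ModMon n r) : ModMon n r :=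
  (ν + μ.1, μ.2)

/-- A monomial order on `R^r`: a total order on the monomials of `R^r` such that
`μ₁ ≤ μ₂` implies `μ₁ ≤ ν·μ₁ ≤ ν·μ₂` for every ring monomial `ν`. -/
structure ModMonomialOrder (n r : ℕ) where
  le : ModMon n r → ModMon n r → Prop
  le_refl : ∀ a, le a a
  le_trans : ∀ a b c, le a b → le b c → le a c
  le_antisymm : ∀ a b, le a b → le b a → a = b
  le_total : ∀ a b, le a b ∨ le b a
  compat : ∀ (ν : Fin n →₀ ℕ) (a b : ModMon n r),
    le a b → le a (smulMon ν a) ∧ le (smulMon ν a) (smulMon ν b)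

/-- The strict order associated with a monomial order. -/
def ModMonomialOrder.lt {n r : ℕ} (ord : ModMonomialOrder n r)
    (a b : ModMon n r) : Prop :=
  ord.le a b ∧ a ≠ b

/-- The module monomial `μ = ν eᵢ` as an element of `R^r`. -/
noncomputable def monElem (K : Type) [Field K] {n r : ℕ} (μ : ModMon n r) :
    Fin r → MvPolynomial (Fin n) K :=
  Pi.single μ.2 (monomial μ.1 (1 : K))

/-- `μ` is the `ord`-leading monomial of `p ∈ R^r`: it appears in `p` and every
monomial appearing in `p` is `≤ μ`. -/
def IsLM {K : Type} [Field K] {n r : ℕ} (ord : ModMonomialOrder n r)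
    (p : Fin r → MvPolynomial (Fin n) K) (μ : ModMon n r) : Prop :=
  coeff μ.1 (p μ.2) ≠ 0 ∧
  ∀ (m : Fin n →₀ ℕ) (i : Fin r), coeff m (p i) ≠ 0 → ord.le (m, i) μ

/-- Divisibility of module monomials: `μ ∣ μ'` iff `μ' = ν·μ` for a ring monomial `ν`. -/
def monDvd {n r : ℕ} (μ μ' : ModMon n r) : Prop :=
  ∃ ν : Fin n →₀ ℕ, smulMon ν μ = μ'

/-- The `ord`-leading module of a submodule `M ⊆ R^r`: the submodule generated by
the leading monomials of the nonzero elements of `M`. -/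
noncomputable def leadingSubmodule {K : Type} [Field K] {n r : ℕ}
    (ord : ModMonomialOrder n r)
    (M : Submodule (MvPolynomial (Fin n) K) (Fin r → MvPolynomial (Fin n) K)) :
    Submodule (MvPolynomial (Fin n) K) (Fin r → MvPolynomial (Fin n) K) :=
  Submodule.span (MvPolynomial (Fin n) K)
    {v | ∃ p ∈ M, ∃ μ : ModMon n r, IsLM ord p μ ∧ v = monElem K μ}

/-- `G` is a `ord`-Gröbner basis of `M`. -/
def IsGB {K : Type} [Field K] {n r : ℕ} {ι : Type} (ord : ModMonomialOrder n r)
    (M : Submodule (MvPolynomial (Fin n) K) (Fin r → MvPolynomial (Fin n) K))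
    (G : ι → Fin r → MvPolynomial (Fin n) K) : Prop :=
  (∀ i, G i ∈ M) ∧
  leadingSubmodule ord M =
    Submodule.span (MvPolynomial (Fin n) K)
      {v | ∃ (i : ι) (μ : ModMon n r), IsLM ord (G i) μ ∧ v = monElem K μ}

/-- `G` is a minimal `ord`-Gröbner basis of `M`: no leading monomial of an element
divides that of another element. -/
def IsMinimalGB {K : Type} [Field K] {n r : ℕ} {ι : Type} (ord : ModMonomialOrder n r)
    (M : Submodule (MvPolynomial (Fin n) K) (Fin r → MvPolynomial (Fin n) K))
    (G : ι → Fin r → MvPolynomial (Fin n) K) : Prop :=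
  IsGB ord M G ∧
  ∀ (i j : ι), i ≠ j → ∀ (μi μj : ModMon n r),
    IsLM ord (G i) μi → IsLM ord (G j) μj → ¬ monDvd μi μj

/-- `G` is the reduced `ord`-Gröbner basis of `M`: minimal, leading coefficients `1`,
and no term of `G i` is divisible by the leading monomial of `G j` for `j ≠ i`. -/
def IsReducedGB {K : Type} [Field K] {n r : ℕ} {ι : Type} (ord : ModMonomialOrder n r)
    (M : Submodule (MvPolynomial (Fin n) K) (Fin r → MvPolynomial (Fin n) K))
    (G : ι → Fin r → MvPolynomial (Fin n) K) : Prop :=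
  IsMinimalGB ord M G ∧
  (∀ (i : ι) (μi : ModMon n r), IsLM ord (G i) μi → coeff μi.1 (G i μi.2) = 1) ∧
  (∀ (i j : ι), i ≠ j → ∀ (μj : ModMon n r), IsLM ord (G j) μj →
    ∀ (m : Fin n →₀ ℕ) (l : Fin r), coeff m (G i l) ≠ 0 → ¬ monDvd μj (m, l))

/-- The rows of the elementary matrix `E ∈ R^{(k+n-1)×k}` with pivot `π`,
constants `lam i` (for `i ≠ π`) and `α j`: the rows `εᵢ + λᵢ ε_π` for `i ≠ π`
and `(Xⱼ - αⱼ) ε_π` for `1 ≤ j ≤ n`. -/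
noncomputable def elemRow {K : Type} [Field K] {n k : ℕ} (π : Fin k)
    (lam : Fin k → K) (α : Fin n → K) :
    ({i : Fin k // i ≠ π} ⊕ Fin n) → Fin k → MvPolynomial (Fin n) K :=
  Sum.elim
    (fun i => Pi.single i.1 (1 : MvPolynomial (Fin n) K)
      + lam i.1 • (Pi.single π 1 : Fin k → MvPolynomial (Fin n) K))
    (fun j => (X j - C (α j)) • (Pi.single π 1 : Fin k → MvPolynomial (Fin n) K))

/-- Rows of the matrix product `E·G` where `E` has rows in `R^k` indexed by `ι`
and `G ∈ R^{k×r}`. -/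
noncomputable def rowMul {K : Type} [Field K] {n k r : ℕ} {ι : Type}
    (E : ι → Fin k → MvPolynomial (Fin n) K)
    (G : Fin k → Fin r → MvPolynomial (Fin n) K) :
    ι → Fin r → MvPolynomial (Fin n) K :=
  fun a c => ∑ b, E a b * G b c

/-- `sord` is a Schreyer order for `ord` and the list of monomials `LM`. -/
def IsSchreyerOrder {n r k : ℕ} (ord : ModMonomialOrder n r)
    (LM : Fin k → ModMon n r) (sord : ModMonomialOrder n k) : Prop :=
  ∀ (ν₁ ν₂ : Fin n →₀ ℕ) (i j : Fin k),
    ord.lt (smulMon ν₁ (LM i)) (smulMon ν₂ (LM j)) → sord.le (ν₁, i) (ν₂, j)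

/-- Row vector times matrix, as a linear map `R^r → R^s`. -/
noncomputable def vecMulLin {K : Type} [Field K] {n r s : ℕ}
    (F : Fin r → Fin s → MvPolynomial (Fin n) K) :
    (Fin r → MvPolynomial (Fin n) K) →ₗ[MvPolynomial (Fin n) K]
      (Fin s → MvPolynomial (Fin n) K) :=
  Matrix.vecMulLinear (Matrix.of F)

/-- The syzygy module `Syz_N(F) = {p ∈ R^r : pF ∈ N}`. -/
noncomputable def Syz {K : Type} [Field K] {n r s : ℕ}
    (N : Submodule (MvPolynomial (Fin n) K) (Fin s → MvPolynomial (Fin n) K))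
    (F : Fin r → Fin s → MvPolynomial (Fin n) K) :
    Submodule (MvPolynomial (Fin n) K) (Fin r → MvPolynomial (Fin n) K) :=
  Submodule.comap (vecMulLin F) N

/-- `keepIdx K μ π j` holds iff `Xⱼ·μ_π` does not belong to the submodule of `R^r`
generated by the monomials `μ i`, `i ≠ π`. -/
def keepIdx (K : Type) [Field K] {n r k : ℕ} (μ : Fin k → ModMon n r) (π : Fin k)
    (j : Fin n) : Prop :=
  monElem K (smulMon (Finsupp.single j 1) (μ π)) ∉
    Submodule.span (MvPolynomial (Fin n) K)
      {v | ∃ i : Fin k, i ≠ π ∧ v = monElem K (μ i)}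

/-- The rows of the submatrix of the elementary matrix with pivot `π` keeping,
among the rows `(Xⱼ - αⱼ) ε_π`, only those with `P j`. -/
noncomputable def prunedRow {K : Type} [Field K] {n k : ℕ} (π : Fin k)
    (lam : Fin k → K) (α : Fin n → K) (P : Fin n → Prop) :
    ({i : Fin k // i ≠ π} ⊕ {j : Fin n // P j}) → Fin k → MvPolynomial (Fin n) K :=
  Sum.elim
    (fun i => Pi.single i.1 (1 : MvPolynomial (Fin n) K)
      + lam i.1 • (Pi.single π 1 : Fin k → MvPolynomial (Fin n) K))
    (fun j => (X j.1 - C (α j.1)) • (Pi.single π 1 : Fin k → MvPolynomial (Fin n) K))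

/-- Truncation of a polynomial: delete all terms whose monomial lies in
`⟨X₁^{δ₁+1},…,Xₙ^{δₙ+1}⟩`, i.e. keep the terms with `Xᵢ`-degree at most `δᵢ`
for all `i`. -/
noncomputable def truncPoly {K : Type} [Field K] {n : ℕ} (δ : Fin n → ℕ)
    (f : MvPolynomial (Fin n) K) : MvPolynomial (Fin n) K :=
  ∑ m ∈ f.support.filter (fun m => ∀ i, m i ≤ δ i), monomial m (coeff m f)

theorem coeff_truncPoly {K : Type} [Field K] {n : ℕ} (δ : Fin n → ℕ)
    (f : MvPolynomial (Fin n) K) (m : Fin n →₀ ℕ) :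
    coeff m (truncPoly δ f) = if ∀ i, m i ≤ δ i then coeff m f else 0 := by
  classical
  simp only [truncPoly, coeff_sum, coeff_monomial, Finset.sum_ite_eq', Finset.mem_filter,
    mem_support_iff]
  by_cases hf : coeff m f = 0 <;> simp [hf]

theorem mem_span_X_pow_iff {K : Type} [Field K] {n : ℕ} (δ : Fin n → ℕ)
    (f : MvPolynomial (Fin n) K) :
    f ∈ Ideal.span (Set.range (fun i : Fin n => (X i : MvPolynomial (Fin n) K) ^ δ i)) ↔
      ∀ m, coeff m f ≠ 0 → ∃ i, δ i ≤ m i := by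
  have h : Set.range (fun i : Fin n => (X i : MvPolynomial (Fin n) K) ^ δ i) =
      (fun m => monomial m (1 : K)) '' Set.range (fun i => Finsupp.single i (δ i)) := by
    rw [← Set.range_comp]
    simp only [X_pow_eq_monomial, Function.comp_def]
  rw [h, mem_ideal_span_monomial_image]
  simp

theorem sub_truncPoly_mem {K : Type} [Field K] {n : ℕ} (δ : Fin n → ℕ)
    (f : MvPolynomial (Fin n) K) :
    f - truncPoly δ f ∈
      Ideal.span (Set.range (fun i : Fin n => (X i : MvPolynomial (Fin n) K) ^ δ i)) := by
  rw [mem_span_X_pow_iff]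
  intro m hm
  by_contra! h
  simp [coeff_truncPoly, fun i => (h i).le] at hm

theorem mem_Syz_of_forall_mem {K : Type} [Field K] {n r s : ℕ}
    {J : Ideal (MvPolynomial (Fin n) K)} (F : Fin r → Fin s → MvPolynomial (Fin n) K)
    {p : Fin r → MvPolynomial (Fin n) K} (hp : ∀ c, p c ∈ J) :
    p ∈ Syz (Submodule.pi Set.univ (fun _ : Fin s => J)) F := by
  intro d _
  change ∑ c, p c * F c d ∈ J
  exact J.sum_mem fun c _ => J.mul_mem_right _ (hp c)

theorem isLM_monElem {K : Type} [Field K] {n r : ℕ} (ord : ModMonomialOrder n r)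
    (μ : ModMon n r) : IsLM ord (monElem K μ) μ := by
  classical
  refine ⟨by simp [monElem], fun m i h => ?_⟩
  obtain ⟨a, c⟩ := μ
  by_cases hi : i = c
  · subst hi
    obtain rfl : a = m := by
      by_contra hne
      simp [monElem, coeff_monomial, hne] at h
    exact ord.le_refl _
  · simp [monElem, hi] at h

theorem IsLM.unique {K : Type} [Field K] {n r : ℕ} {ord : ModMonomialOrder n r}
    {p : Fin r → MvPolynomial (Fin n) K} {μ ν : ModMon n r}
    (hμ : IsLM ord p μ) (hν : IsLM ord p ν) : μ = ν :=
  ord.le_antisymm _ _ (hν.2 _ _ hμ.1) (hμ.2 _ _ hν.1)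

theorem ModMonomialOrder.exists_greatest {n r : ℕ} (ord : ModMonomialOrder n r)
    (S : Finset (ModMon n r)) (hS : S.Nonempty) : ∃ μ ∈ S, ∀ ν ∈ S, ord.le ν μ := by
  induction hS using Finset.Nonempty.cons_induction with
  | singleton a => exact ⟨a, by simp, by simp [ord.le_refl]⟩
  | cons a S _ _ ih =>
    obtain ⟨μ, hμ, hmax⟩ := ih
    rcases ord.le_total a μ with h | h
    · refine ⟨μ, by simp [hμ], fun ν hν => ?_⟩
      rcases Finset.mem_cons.1 hν with rfl | hν
      exacts [h, hmax ν hν]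
    · refine ⟨a, by simp, fun ν hν => ?_⟩
      rcases Finset.mem_cons.1 hν with rfl | hν
      exacts [ord.le_refl _, ord.le_trans _ _ _ (hmax ν hν) h]

theorem exists_isLM {K : Type} [Field K] {n r : ℕ} (ord : ModMonomialOrder n r)
    {p : Fin r → MvPolynomial (Fin n) K} {m : Fin n →₀ ℕ} {c : Fin r}
    (h : coeff m (p c) ≠ 0) : ∃ μ, IsLM ord p μ := by
  classical
  let S : Finset (ModMon n r) :=
    Finset.univ.biUnion fun c => (p c).support.image fun m => (m, c)
  have hS : ∀ μ : ModMon n r, μ ∈ S ↔ coeff μ.1 (p μ.2) ≠ 0 := by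
    rintro ⟨a, b⟩
    simp [S]
  obtain ⟨μ, hμ, hmax⟩ := ord.exists_greatest S ⟨(m, c), (hS _).2 h⟩
  exact ⟨μ, (hS μ).1 hμ, fun m i hm => hmax _ ((hS (m, i)).2 hm)⟩

theorem exists_monDvd_of_mem_span {K : Type} [Field K] {n r : ℕ} {S : Set (ModMon n r)}
    {v : Fin r → MvPolynomial (Fin n) K}
    (hv : v ∈ Submodule.span (MvPolynomial (Fin n) K) (monElem K '' S))
    {m : Fin n →₀ ℕ} {c : Fin r} (h : coeff m (v c) ≠ 0) :
    ∃ μ ∈ S, monDvd μ (m, c) := by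
  classical
  induction hv using Submodule.span_induction generalizing m c with
  | mem v hv =>
    obtain ⟨⟨a, b⟩, hμ, rfl⟩ := hv
    by_cases hc : c = b
    · subst hc
      obtain rfl : a = m := by
        by_contra hne
        simp [monElem, coeff_monomial, hne] at h
      exact ⟨_, hμ, 0, by simp [smulMon]⟩
    · simp [monElem, hc] at h
  | zero => simp at h
  | add u w _ _ hu hw =>
    by_cases h' : coeff m (u c) = 0
    · exact hw (by simpa [h'] using h)
    · exact hu h'
  | smul a w _ hw =>
    rw [Pi.smul_apply, smul_eq_mul, coeff_mul] at h
    obtain ⟨⟨x, y⟩, hxy, hne⟩ := Finset.exists_ne_zero_of_sum_ne_zero h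
    obtain ⟨μ, hμ, ν, hν⟩ := hw (right_ne_zero_of_mul hne)
    refine ⟨μ, hμ, x + ν, ?_⟩
    rw [Finset.HasAntidiagonal.mem_antidiagonal] at hxy
    simp only [smulMon, Prod.mk.injEq] at hν ⊢
    exact ⟨by rw [add_assoc, hν.1, hxy], hν.2⟩

theorem IsGB.exists_monDvd {K : Type} [Field K] {n r : ℕ} {ι : Type}
    {ord : ModMonomialOrder n r}
    {M : Submodule (MvPolynomial (Fin n) K) (Fin r → MvPolynomial (Fin n) K)}
    {G : ι → Fin r → MvPolynomial (Fin n) K} (hG : IsGB ord M G)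
    {p : Fin r → MvPolynomial (Fin n) K} (hp : p ∈ M) {μ : ModMon n r} (hμ : IsLM ord p μ) :
    ∃ i ν, IsLM ord (G i) ν ∧ monDvd ν μ := by
  have hmem : monElem K μ ∈ leadingSubmodule ord M :=
    Submodule.subset_span ⟨p, hp, μ, hμ, rfl⟩
  have hset : {v | ∃ (i : ι) (μ : ModMon n r), IsLM ord (G i) μ ∧ v = monElem K μ} =
      monElem K '' {ν | ∃ i, IsLM ord (G i) ν} := by
    ext v
    constructor
    · rintro ⟨i, ν, hν, rfl⟩
      exact ⟨ν, ⟨i, hν⟩, rfl⟩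
    · rintro ⟨ν, ⟨i, hν⟩, rfl⟩
      exact ⟨i, ν, hν, rfl⟩
  rw [hG.2, hset] at hmem
  obtain ⟨ν, ⟨i, hν⟩, hdvd⟩ := exists_monDvd_of_mem_span hmem (isLM_monElem (K := K) ord μ).1
  exact ⟨i, ν, hν, hdvd⟩

/-- If `M` contains every `Xⱼ^{δⱼ} e_c`, the leading monomials of a minimal Gröbner basis of `M`
have `Xⱼ`-degree at most `δⱼ`. -/
theorem IsMinimalGB.degree_le {K : Type} [Field K] {n r : ℕ} {ι : Type}
    {ord : ModMonomialOrder n r}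
    {M : Submodule (MvPolynomial (Fin n) K) (Fin r → MvPolynomial (Fin n) K)}
    {G : ι → Fin r → MvPolynomial (Fin n) K} (hG : IsMinimalGB ord M G) {δ : Fin n → ℕ}
    (hM : ∀ j c, monElem K (Finsupp.single j (δ j), c) ∈ M)
    {a : ι} {μ : ModMon n r} (hμ : IsLM ord (G a) μ) (j : Fin n) : μ.1 j ≤ δ j := by
  by_contra! hlt
  obtain ⟨b, ν, hν, ρ, hρ⟩ := hG.1.exists_monDvd (hM j μ.2) (isLM_monElem ord _)
  simp only [smulMon, Prod.mk.injEq] at hρ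
  have hle : Finsupp.single j (δ j) ≤ μ.1 := by simpa using hlt.le
  by_cases hab : b = a
  · subst hab
    obtain rfl := hμ.unique hν
    have := DFunLike.congr_fun hρ.1 j
    simp at this
    omega
  · refine hG.2 b a hab ν μ hν hμ ⟨μ.1 - Finsupp.single j (δ j) + ρ, ?_⟩
    simp only [smulMon, add_assoc, hρ.1, hρ.2, tsub_add_cancel_of_le hle]

theorem IsLM.truncPoly {K : Type} [Field K] {n r : ℕ} {ord : ModMonomialOrder n r}
    {p : Fin r → MvPolynomial (Fin n) K} {μ : ModMon n r} (hμ : IsLM ord p μ)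
    {δ : Fin n → ℕ} (hδ : ∀ j, μ.1 j ≤ δ j) : IsLM ord (fun c => truncPoly δ (p c)) μ := by
  refine ⟨by simpa [coeff_truncPoly, hδ] using hμ.1, fun m i h => hμ.2 m i fun h0 => h ?_⟩
  simp [coeff_truncPoly, h0]

/-- For `N = J × … × J` with `J = ⟨X₁^{δ₁},…,Xₙ^{δₙ}⟩`,
truncating each element of a minimal `≤`-Gröbner basis of `Syz_N(F)` modulo
`⟨X₁^{δ₁+1},…,Xₙ^{δₙ+1}⟩` in each coordinate again yields a minimal
`≤`-Gröbner basis of `Syz_N(F)`. -/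
theorem statement16 {K : Type} [Field K] {n r s : ℕ}
    (δ : Fin n → ℕ) (hδ : ∀ i, 0 < δ i)
    (N : Submodule (MvPolynomial (Fin n) K) (Fin s → MvPolynomial (Fin n) K))
    (hN : N = Submodule.pi Set.univ (fun _ : Fin s =>
      Ideal.span (Set.range (fun i : Fin n => (X i : MvPolynomial (Fin n) K) ^ δ i))))
    (F : Fin r → Fin s → MvPolynomial (Fin n) K)
    (ord : ModMonomialOrder n r)
    {k : ℕ} (G : Fin k → Fin r → MvPolynomial (Fin n) K)
    (hG : IsMinimalGB ord (Syz N F) G) :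
    IsMinimalGB ord (Syz N F) (fun a c => truncPoly δ (G a c)) := by
  subst hN
  have hM (j : Fin n) (c : Fin r) : monElem K (Finsupp.single j (δ j), c) ∈
      Syz (Submodule.pi Set.univ (fun _ : Fin s =>
        Ideal.span (Set.range (fun i : Fin n => (X i : MvPolynomial (Fin n) K) ^ δ i)))) F := by
    refine mem_Syz_of_forall_mem F fun d => ?_
    by_cases hd : d = c
    · subst hd
      simp only [monElem, Pi.single_eq_same, ← X_pow_eq_monomial]
      exact Ideal.subset_span ⟨j, rfl⟩
    · simp [monElem, hd]
  have hlm (a : Fin k) (μ : ModMon n r) :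
      IsLM ord (fun c => truncPoly δ (G a c)) μ ↔ IsLM ord (G a) μ := by
    have hto {ν : ModMon n r} (hν : IsLM ord (G a) ν) :
        IsLM ord (fun c => truncPoly δ (G a c)) ν := hν.truncPoly (hG.degree_le hM hν)
    refine ⟨fun hμ => ?_, hto⟩
    obtain ⟨ν, hν⟩ := exists_isLM ord (p := G a) (m := μ.1) (c := μ.2) fun h0 =>
      hμ.1 (by simp [coeff_truncPoly, h0])
    rwa [hμ.unique (hto hν)]
  refine ⟨⟨fun a => ?_, ?_⟩, ?_⟩
  · have hdiff := mem_Syz_of_forall_mem F fun c => sub_truncPoly_mem δ (G a c)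
    convert Submodule.sub_mem _ (hG.1.1 a) hdiff using 1
    ext1 c
    simp
  · simpa only [hlm] using hG.1.2
  · simpa only [hlm] using hG.2
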